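/- arXiv:0806.4636 — 5 statements merged into one kernel-verified Lean document; each statement's English description precedes it below -/
import Mathlib

section
/- Let P ⊆ {1,…,m} × {1,…,n} be a set of index pairs. Consider variables (x, y, z, w) ∈ V × ℝᵐ × Z × W, where V ⊆ ℝⁿ is open, z = (z^μ_i)_{(μ,i)∈P} ∈ Z ⊆ ℝ^P are the first-order jet variables present in the partial jet bundle, w ∈ W ⊆ ℝ^d collects all higher-order jet variables, and Z, W are open and convex. Let p and F^i_μ (for (μ,i) ∈ P) be smooth real-valued functions of (x, y, z, w). Then the following are equivalent: (i) for all (ν,j) ∈ P, F^j_ν = ∂_{z^ν_j}( p + Σ_{(μ,k)∈P} z^μ_k F^k_μ ), and for every higher-order variable w_a, ∂_{w_a}( p + Σ_{(μ,k)∈P} z^μ_k F^k_μ ) = 0; (ii) there exist a smooth function L depending only on (x, y, z) and a smooth function l depending only on (x, y) such that F^j_ν = ∂_{z^ν_j} L for all (ν,j) ∈ P and p = L − Σ_{(μ,k)∈P} z^μ_k ∂_{z^μ_k} L + l. -/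
open scoped BigOperators

namespace SemiLagrangian

/-- The index set of first-order jet variables present in the partial jet bundle. -/
abbrev Idx (m n : ℕ) (P : Finset (Fin m × Fin n)) : Type := {q : Fin m × Fin n // q ∈ P}

/-- The total space of variables `(x, y, z, w)` where `z = (z^μ_i)_{(μ,i)∈P}` are the
first-order jet variables present in the partial jet bundle and `w` collects all
higher-order jet variables. -/
abbrev Tot (n m d : ℕ) (P : Finset (Fin m × Fin n)) : Type :=
  (Fin n → ℝ) × (Fin m → ℝ) × (Idx m n P → ℝ) × (Fin d → ℝ)

/-- The coordinate direction `∂_{z^ν_j}` (for `(ν,j) ∈ P`). -/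
def dzT (n m d : ℕ) (P : Finset (Fin m × Fin n)) (q : Idx m n P) : Tot n m d P :=
  (0, 0, Pi.single q 1, 0)

/-- The coordinate direction `∂_{w_a}` along a higher-order jet variable. -/
def dwT (n m d : ℕ) (P : Finset (Fin m × Fin n)) (a : Fin d) : Tot n m d P :=
  (0, 0, 0, Pi.single a 1)

/-- The domain `V × ℝᵐ × Z × W`. -/
def dom {n m d : ℕ} (P : Finset (Fin m × Fin n)) (V : Set (Fin n → ℝ))
    (Z : Set (Idx m n P → ℝ)) (W : Set (Fin d → ℝ)) : Set (Tot n m d P) :=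
  {e | e.1 ∈ V ∧ e.2.2.1 ∈ Z ∧ e.2.2.2 ∈ W}

/-- The combination `p + Σ_{(μ,k)∈P} z^μ_k F^k_μ`. -/
def comb {n m d : ℕ} (P : Finset (Fin m × Fin n))
    (p : Tot n m d P → ℝ) (F : Idx m n P → Tot n m d P → ℝ) : Tot n m d P → ℝ :=
  fun e => p e + ∑ q : Idx m n P, e.2.2.1 q * F q e

section

variable {n m d : ℕ} {P : Finset (Fin m × Fin n)} {V : Set (Fin n → ℝ)}
  {Z : Set (Idx m n P → ℝ)} {W : Set (Fin d → ℝ)}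

/-- The projection `(x, y, z, w) ↦ (x, y, z)`. -/
def forgetW (n m d : ℕ) (P : Finset (Fin m × Fin n)) :
    Tot n m d P →L[ℝ] (Fin n → ℝ) × (Fin m → ℝ) × (Idx m n P → ℝ) :=
  (ContinuousLinearMap.id ℝ _).prodMap
    ((ContinuousLinearMap.id ℝ _).prodMap (ContinuousLinearMap.fst ℝ _ _))

/-- The projection `(x, y, z) ↦ (x, y)`. -/
def forgetZ (n m : ℕ) (P : Finset (Fin m × Fin n)) :
    (Fin n → ℝ) × (Fin m → ℝ) × (Idx m n P → ℝ) →L[ℝ] (Fin n → ℝ) × (Fin m → ℝ) :=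
  (ContinuousLinearMap.id ℝ _).prodMap (ContinuousLinearMap.fst ℝ _ _)

lemma isOpen_dom (hV : IsOpen V) (hZ : IsOpen Z) (hW : IsOpen W) :
    IsOpen (dom P V Z W : Set (Tot n m d P)) :=
  (hV.preimage continuous_fst).inter
    ((hZ.preimage (by fun_prop : Continuous fun e : Tot n m d P => e.2.2.1)).inter
      (hW.preimage (by fun_prop : Continuous fun e : Tot n m d P => e.2.2.2)))

lemma isOpen_firstOrderDom (hV : IsOpen V) (hZ : IsOpen Z) :
    IsOpen {u : (Fin n → ℝ) × (Fin m → ℝ) × (Idx m n P → ℝ) | u.1 ∈ V ∧ u.2.2 ∈ Z} :=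
  (hV.preimage continuous_fst).inter (hZ.preimage (continuous_snd.comp continuous_snd))

lemma contDiffOn_comb {N : WithTop ℕ∞} {s : Set (Tot n m d P)} {p : Tot n m d P → ℝ}
    {F : Idx m n P → Tot n m d P → ℝ} (hp : ContDiffOn ℝ N p s)
    (hF : ∀ q, ContDiffOn ℝ N (F q) s) : ContDiffOn ℝ N (comb P p F) s := by
  unfold comb
  refine hp.add (ContDiffOn.sum fun q _ => ContDiffOn.mul ?_ (hF q))
  fun_prop

/-- If `f` agrees on the domain with a function `g` of `(x, y, z)`, its derivatives are those
of `g`. -/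
lemma fderiv_eq_of_eqOn_dom (hdom : IsOpen (dom P V Z W)) {f : Tot n m d P → ℝ}
    {g : (Fin n → ℝ) × (Fin m → ℝ) × (Idx m n P → ℝ) → ℝ}
    (h : Set.EqOn f (g ∘ forgetW n m d P) (dom P V Z W)) {e : Tot n m d P}
    (he : e ∈ dom P V Z W) (hg : DifferentiableAt ℝ g (forgetW n m d P e)) (v : Tot n m d P) :
    fderiv ℝ f e v = fderiv ℝ g (forgetW n m d P e) (forgetW n m d P v) := by
  rw [(h.eventuallyEq_of_mem (hdom.mem_nhds he)).fderiv_eq,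
    fderiv_comp e hg (forgetW n m d P).differentiableAt, ContinuousLinearMap.fderiv]
  rfl

/-- A function whose derivatives along the higher-order variables vanish does not depend on
them. -/
lemma eq_of_fderiv_dwT_eq_zero (hdom : IsOpen (dom P V Z W)) (hW : IsOpen W)
    (hWconv : Convex ℝ W) {f : Tot n m d P → ℝ} (hf : DifferentiableOn ℝ f (dom P V Z W))
    (h : ∀ a, ∀ e ∈ dom P V Z W, fderiv ℝ f e (dwT n m d P a) = 0)
    {x : Fin n → ℝ} {y : Fin m → ℝ} {z : Idx m n P → ℝ} (hx : x ∈ V) (hz : z ∈ Z)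
    {w w' : Fin d → ℝ} (hw : w ∈ W) (hw' : w' ∈ W) :
    f (x, y, z, w) = f (x, y, z, w') := by
  have hderiv : ∀ u ∈ W, HasFDerivAt (fun t => f (x, y, z, t)) (0 : (Fin d → ℝ) →L[ℝ] ℝ) u := by
    intro u hu
    have hmem : (x, y, z, u) ∈ dom P V Z W := ⟨hx, hz, hu⟩
    have hinc : HasFDerivAt (fun t => ((x, y, z, t) : Tot n m d P))
        ((0 : (Fin d → ℝ) →L[ℝ] (Fin n → ℝ)).prod ((0 : (Fin d → ℝ) →L[ℝ] (Fin m → ℝ)).prod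
          ((0 : (Fin d → ℝ) →L[ℝ] (Idx m n P → ℝ)).prod (.id ℝ _)))) u :=
      .prodMk (hasFDerivAt_const x u) (.prodMk (hasFDerivAt_const y u)
        (.prodMk (hasFDerivAt_const z u) (hasFDerivAt_id u)))
    have hfu := ((hf _ hmem).differentiableAt (hdom.mem_nhds hmem)).hasFDerivAt
    refine (hfu.comp u hinc).congr_fderiv (ContinuousLinearMap.coe_injective
      (LinearMap.pi_ext' fun a => LinearMap.ext_ring ?_))
    exact h a _ hmem
  exact hW.is_const_of_fderiv_eq_zero hWconv.isPreconnected
    (fun u hu => (hderiv u hu).differentiableAt.differentiableWithinAt)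
    (fun u hu => (hderiv u hu).fderiv) hw hw'

end

/-- Characterization of covering constitutive relations with vanishing contact
obstruction: `F^j_ν = ∂_{z^ν_j}(p + Σ z F)` for all `(ν,j) ∈ P` and
`∂_{w_a}(p + Σ z F) = 0` for all higher-order variables hold iff the relation is
semi-P-Lagrangian: `F^j_ν = ∂_{z^ν_j}L` for a first-order Lagrangian `L = L(x,y,z)` and
`p = L − Σ_{(μ,k)∈P} z^μ_k ∂_{z^μ_k}L + l(x,y)`. -/
theorem semiPLagrangian_characterization {n m d : ℕ}
    (P : Finset (Fin m × Fin n))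
    (V : Set (Fin n → ℝ)) (Z : Set (Idx m n P → ℝ)) (W : Set (Fin d → ℝ))
    (hV : IsOpen V) (hZ : IsOpen Z) (hZconv : Convex ℝ Z)
    (hW : IsOpen W) (hWconv : Convex ℝ W)
    (p : Tot n m d P → ℝ) (F : Idx m n P → Tot n m d P → ℝ)
    (hp : ContDiffOn ℝ (⊤ : ℕ∞) p (dom P V Z W))
    (hF : ∀ q, ContDiffOn ℝ (⊤ : ℕ∞) (F q) (dom P V Z W)) :
    -- (i)
    ((∀ q : Idx m n P, ∀ e ∈ dom P V Z W,
        F q e = fderiv ℝ (comb P p F) e (dzT n m d P q))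
      ∧ (∀ a : Fin d, ∀ e ∈ dom P V Z W,
        fderiv ℝ (comb P p F) e (dwT n m d P a) = 0))
    ↔
    -- (ii)
    (∃ L : (Fin n → ℝ) × (Fin m → ℝ) × (Idx m n P → ℝ) → ℝ,
      ∃ l : (Fin n → ℝ) × (Fin m → ℝ) → ℝ,
        ContDiffOn ℝ (⊤ : ℕ∞) L {u | u.1 ∈ V ∧ u.2.2 ∈ Z}
        ∧ ContDiffOn ℝ (⊤ : ℕ∞) l {u | u.1 ∈ V}
        ∧ (∀ e ∈ dom P V Z W, ∀ q : Idx m n P,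
            F q e = fderiv ℝ L (e.1, e.2.1, e.2.2.1) (0, 0, Pi.single q 1))
        ∧ (∀ e ∈ dom P V Z W,
            p e = L (e.1, e.2.1, e.2.2.1)
              - ∑ q : Idx m n P,
                  e.2.2.1 q * fderiv ℝ L (e.1, e.2.1, e.2.2.1) (0, 0, Pi.single q 1)
              + l (e.1, e.2.1))) := by
  have hdom := isOpen_dom (m := m) hV hZ hW
  have hcomb := contDiffOn_comb hp hF
  have hfo := isOpen_firstOrderDom (m := m) hV hZ
  constructor
  · rintro ⟨hz, hw⟩
    rcases W.eq_empty_or_nonempty with rfl | ⟨w₀, hw₀⟩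
    · exact ⟨0, 0, contDiffOn_const, contDiffOn_const, fun e he => he.2.2.elim,
        fun e he => he.2.2.elim⟩
    set L : (Fin n → ℝ) × (Fin m → ℝ) × (Idx m n P → ℝ) → ℝ :=
      fun u => comb P p F (u.1, u.2.1, u.2.2, w₀) with hLdef
    have hL : ContDiffOn ℝ (⊤ : ℕ∞) L {u | u.1 ∈ V ∧ u.2.2 ∈ Z} :=
      hcomb.comp (ContDiff.contDiffOn (by fun_prop)) fun u hu => ⟨hu.1, hu.2, hw₀⟩
    have hEq : Set.EqOn (comb P p F) (L ∘ forgetW n m d P) (dom P V Z W) := fun e he =>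
      eq_of_fderiv_dwT_eq_zero hdom hW hWconv (hcomb.differentiableOn (by simp)) hw
        he.1 he.2.1 he.2.2 hw₀
    have hFL : ∀ e ∈ dom P V Z W, ∀ q : Idx m n P,
        F q e = fderiv ℝ L (e.1, e.2.1, e.2.2.1) (0, 0, Pi.single q 1) := fun e he q =>
      (hz q e he).trans (fderiv_eq_of_eqOn_dom hdom hEq he
        ((hL.contDiffAt (hfo.mem_nhds ⟨he.1, he.2.1⟩)).differentiableAt (by simp)) _)
    refine ⟨L, 0, hL, contDiffOn_const, hFL, fun e he => ?_⟩
    simp only [← hFL e he]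
    have hLe : p e + ∑ q : Idx m n P, e.2.2.1 q * F q e = L (e.1, e.2.1, e.2.2.1) := hEq he
    simp [← hLe]
  · rintro ⟨L, l, hL, hl, hFL, hpL⟩
    have hEq : Set.EqOn (comb P p F) ((L + l ∘ forgetZ n m P) ∘ forgetW n m d P)
        (dom P V Z W) := by
      intro e he
      have hLe := hpL e he
      simp only [← hFL e he] at hLe
      change p e + ∑ q : Idx m n P, e.2.2.1 q * F q e
        = L (e.1, e.2.1, e.2.2.1) + l (e.1, e.2.1)
      linarith
    have key : ∀ e ∈ dom P V Z W, ∀ v : Tot n m d P, v.1 = 0 → v.2.1 = 0 →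
        fderiv ℝ (comb P p F) e v = fderiv ℝ L (e.1, e.2.1, e.2.2.1) (0, 0, v.2.2.1) := by
      rintro e he ⟨_, _, v⟩ rfl rfl
      have hLd : DifferentiableAt ℝ L (forgetW n m d P e) :=
        (hL.contDiffAt (hfo.mem_nhds ⟨he.1, he.2.1⟩)).differentiableAt (by simp)
      have hld : DifferentiableAt ℝ l (forgetZ n m P (forgetW n m d P e)) :=
        (hl.contDiffAt ((hV.preimage continuous_fst).mem_nhds he.1)).differentiableAt (by simp)
      have hld' := hld.comp (forgetW n m d P e) (forgetZ n m P).differentiableAt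
      rw [fderiv_eq_of_eqOn_dom hdom hEq he (hLd.add hld'), fderiv_add hLd hld',
        fderiv_comp _ hld (forgetZ n m P).differentiableAt, ContinuousLinearMap.fderiv]
      change _ + fderiv ℝ l _ 0 = _
      rw [map_zero, add_zero]
      rfl
    refine ⟨fun q e he => (hFL e he q).trans (key e he (dzT n m d P q) rfl rfl).symm, fun a e he => ?_⟩
    exact (key e he (dwT n m d P a) rfl rfl).trans (map_zero _)

end SemiLagrangian
end

section
/- Let F^i_μ, Π_μ : J¹ → ℝ be a smooth first-order constitutive relation, and let ξ^μ : ℝⁿ × ℝᵐ → ℝ (μ = 1,…,m) be smooth components of a vertical vector field ξ = Σ_μ ξ^μ ∂_{y^μ}. Suppose that identically on J¹ the condition FDiv(ξ) = 0 holds: Σ_{i,μ} F^i_μ(x,y,z) · ( ∂_{x^i} ξ^μ(x,y) + Σ_ν z^ν_i ∂_{y^ν} ξ^μ(x,y) ) = 0 for all (x,y,z) ∈ J¹. Then every C² solution s of the balance system also satisfies the secondary balance law Σ_i ∂_{x^i}[ Σ_μ ξ^μ(x, s(x)) F^i_μ(j¹s(x)) ] = Σ_μ ξ^μ(x, s(x))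 Π_μ(j¹s(x)) for all x ∈ ℝⁿ. -/
open scoped BigOperators

/-- The first jet space `J¹ = ℝⁿ × ℝᵐ × ℝ^{m×n}` with coordinates `(xⁱ, y^μ, z^μ_i)`. -/
abbrev Jet1 (n m : ℕ) : Type :=
  (Fin n → ℝ) × (Fin m → ℝ) × (Fin m → Fin n → ℝ)

/-- The first jet `j¹s(x) = (x, s(x), ∂s(x))` of a map `s : ℝⁿ → ℝᵐ`. -/
noncomputable def jet {n m : ℕ} (s : (Fin n → ℝ) → (Fin m → ℝ)) (x : Fin n → ℝ) :
    Jet1 n m :=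
  (x, s x, fun μ i => fderiv ℝ s x (Pi.single i 1) μ)

/-- The partial derivative `∂_{x^i} f(x)` of a scalar function on `ℝⁿ`. -/
noncomputable def pd {n : ℕ} (f : (Fin n → ℝ) → ℝ) (i : Fin n) (x : Fin n → ℝ) : ℝ :=
  fderiv ℝ f x (Pi.single i 1)

theorem differentiable_jet {n m : ℕ} {s : (Fin n → ℝ) → (Fin m → ℝ)}
    (hs : ContDiff ℝ 2 s) : Differentiable ℝ (jet s) := by
  have hds : Differentiable ℝ (fderiv ℝ s) :=
    (hs.fderiv_right (m := 1) (by norm_num)).differentiable (by norm_num)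
  have hs' : Differentiable ℝ s := hs.differentiable (by norm_num)
  refine differentiable_id.prodMk (hs'.prodMk ?_)
  refine differentiable_pi.2 fun μ => differentiable_pi.2 fun i => ?_
  exact differentiable_pi.1 (hds.clm_apply (differentiable_const _)) μ

theorem ContinuousLinearMap.apply_prodMk_eq_add_sum {E G : Type*}
    [NormedAddCommGroup E] [NormedSpace ℝ E] [NormedAddCommGroup G] [NormedSpace ℝ G]
    {m : ℕ} (L : E × (Fin m → ℝ) →L[ℝ] G) (v : E) (w : Fin m → ℝ) :
    L (v, w) = L (v, 0) + ∑ ν, w ν • L (0, Pi.single ν 1) := by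
  have h : (v, w) = (v, (0 : Fin m → ℝ)) + ContinuousLinearMap.inr ℝ E (Fin m → ℝ) w := by simp
  rw [h, map_add]
  congr 1
  conv_lhs => rw [pi_eq_sum_univ' w]
  simp only [map_sum, map_smul, ContinuousLinearMap.inr_apply]

/-- The chain rule `∂_{x^i}[ξ^μ(x, s(x))] = (d_i ξ^μ)(j¹s(x))`. -/
theorem pd_comp_graph {n m : ℕ} {ξ : (Fin n → ℝ) × (Fin m → ℝ) → (Fin m → ℝ)}
    (hξ : Differentiable ℝ ξ) {s : (Fin n → ℝ) → (Fin m → ℝ)} (hs : Differentiable ℝ s)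
    (μ : Fin m) (i : Fin n) (x : Fin n → ℝ) :
    pd (fun x' => ξ (x', s x') μ) i x
      = fderiv ℝ ξ (x, s x) (Pi.single i 1, 0) μ
        + ∑ ν, fderiv ℝ s x (Pi.single i 1) ν
          * fderiv ℝ ξ (x, s x) (0, Pi.single ν 1) μ := by
  have h := hasFDerivAt_pi'.1
    ((hξ (x, s x)).hasFDerivAt.comp x ((hasFDerivAt_id x).prodMk (hs x).hasFDerivAt)) μ
  have h' : pd (fun x' => ξ (x', s x') μ) i x
      = fderiv ℝ ξ (x, s x) (Pi.single i 1, fderiv ℝ s x (Pi.single i 1)) μ := by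
    unfold pd
    erw [h.fderiv]
    rfl
  rw [h', ContinuousLinearMap.apply_prodMk_eq_add_sum]
  simp

theorem pd_sum_mul {n : ℕ} {ι : Type*} [Fintype ι] {f g : ι → (Fin n → ℝ) → ℝ}
    {x : Fin n → ℝ} (hf : ∀ μ, DifferentiableAt ℝ (f μ) x)
    (hg : ∀ μ, DifferentiableAt ℝ (g μ) x) (i : Fin n) :
    pd (fun x' => ∑ μ, f μ x' * g μ x') i x
      = ∑ μ, (f μ x * pd (g μ) i x + g μ x * pd (f μ) i x) := by
  have h := HasFDerivAt.fun_sum (u := Finset.univ)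
    fun μ _ => (hf μ).hasFDerivAt.mul (hg μ).hasFDerivAt
  unfold pd
  erw [h.fderiv]
  simp

/-- If a vertical vector field `ξ = Σ_μ ξ^μ ∂_{y^μ}` satisfies `FDiv(ξ) = Σ F^i_μ d_iξ^μ = 0`
identically on `J¹`, then every solution of the balance system satisfies the secondary
balance law `Σ_i ∂_{x^i}[Σ_μ ξ^μ F^i_μ ∘ j¹s] = Σ_μ ξ^μ Π_μ ∘ j¹s`. -/
theorem secondary_balance_law_of_FDiv_eq_zero {n m : ℕ}
    (F : Fin n → Fin m → Jet1 n m → ℝ) (Pr : Fin m → Jet1 n m → ℝ)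
    (hF : ∀ i μ, ContDiff ℝ (⊤ : ℕ∞) (F i μ)) (hPr : ∀ μ, ContDiff ℝ (⊤ : ℕ∞) (Pr μ))
    (ξ : (Fin n → ℝ) × (Fin m → ℝ) → (Fin m → ℝ)) (hξ : ContDiff ℝ (⊤ : ℕ∞) ξ)
    (hFDiv : ∀ (x : Fin n → ℝ) (y : Fin m → ℝ) (z : Fin m → Fin n → ℝ),
      ∑ i, ∑ μ, F i μ (x, y, z) *
        (fderiv ℝ ξ (x, y) (Pi.single i 1, 0) μ
          + ∑ ν, z ν i * fderiv ℝ ξ (x, y) (0, Pi.single ν 1) μ) = 0)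
    (s : (Fin n → ℝ) → (Fin m → ℝ)) (hs : ContDiff ℝ 2 s)
    (hsol : ∀ (μ : Fin m) (x : Fin n → ℝ),
      ∑ i, pd (fun x' => F i μ (jet s x')) i x = Pr μ (jet s x)) :
    ∀ x : Fin n → ℝ,
      ∑ i, pd (fun x' => ∑ μ, ξ (x', s x') μ * F i μ (jet s x')) i x
        = ∑ μ, ξ (x, s x) μ * Pr μ (jet s x) := by
  intro x
  have hs' : Differentiable ℝ s := hs.differentiable (by norm_num)
  have hξ' : Differentiable ℝ ξ := hξ.differentiable (by simp)
  have hξs (μ : Fin m) : Differentiable ℝ fun x' => ξ (x', s x') μ :=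
    differentiable_pi.1 (hξ'.comp (differentiable_id.prodMk hs')) μ
  have hFs (i : Fin n) (μ : Fin m) : Differentiable ℝ fun x' => F i μ (jet s x') :=
    ((hF i μ).differentiable (by simp)).comp (differentiable_jet hs)
  have hzero : ∑ i, ∑ μ, F i μ (jet s x) * pd (fun x' => ξ (x', s x') μ) i x = 0 := by
    simp only [pd_comp_graph hξ' hs']
    exact hFDiv x (s x) _
  simp only [fun i => pd_sum_mul (fun μ => hξs μ x) (fun μ => hFs i μ x) i,
    Finset.sum_add_distrib]
  rw [hzero, add_zero, Finset.sum_comm]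
  simp only [← Finset.mul_sum, hsol]
end

section
/- Let F^i_μ : J¹ → ℝ be smooth, let ξ = Σ_i ξ^i(x)∂_{x^i} + Σ_μ ξ^μ(x,y)∂_{y^μ} be a smooth projectable vector field, and let ξ¹ be its first prolongation to J¹, with components ξ^μ_i = ∂_{x^i}ξ^μ + Σ_ν z^ν_i ∂_{y^ν}ξ^μ − Σ_j z^μ_j ∂_{x^i}ξ^j. Set p = − Σ_{μ,i} z^μ_i F^i_μ (the lifted covering constitutive relation) and div ξ̄ = Σ_i ∂_{x^i}ξ^i. Suppose that for all pairs (μ, i) the flux symmetry equations hold identically on J¹: ξ¹·F^i_μ + (div ξ̄) F^i_μ + Σ_ν F^i_ν ∂_{y^μ}ξ^ν − Σ_j F^j_μ ∂_{x^j}ξ^i = 0, where ξ¹·F = Σ_j ξ^j ∂_{x^j}F + Σ_ν ξ^ν ∂_{y^ν}F + Σ_{ν,j} ξ^ν_j ∂_{z^ν_j}F. Then the p-symmetry equation holds identically on J¹ as well: ξ¹·p + (div ξ̄) p + Σ_{μ,i} F^i_μ ∂_{x^i}ξ^μ = 0. Consequently, an infinitesimal symmetry of a constitutive relation C is automatically an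 infinitesimal symmetry of its lifted covering constitutive relation C̃, so the correspondence between infinitesimal symmetries of C and of C̃ is a bijection. -/
open scoped BigOperators

/-- The coordinate direction `∂_{x^i}` in `J¹`. -/
def dxDir (n m : ℕ) (i : Fin n) : Jet1 n m := (Pi.single i 1, 0, 0)

/-- The coordinate direction `∂_{y^μ}` in `J¹`. -/
def dyDir (n m : ℕ) (μ : Fin m) : Jet1 n m := (0, Pi.single μ 1, 0)

/-- The coordinate direction `∂_{z^μ_i}` in `J¹`. -/
def dzDir (n m : ℕ) (μ : Fin m) (i : Fin n) : Jet1 n m :=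
  (0, 0, Pi.single μ (Pi.single i 1))

/-- The components `ξ^μ_i = ∂_{x^i}ξ^μ + Σ_ν z^ν_i ∂_{y^ν}ξ^μ − Σ_j z^μ_j ∂_{x^i}ξ^j`
of the first prolongation of a projectable vector field. -/
noncomputable def prolComp {n m : ℕ} (ξb : (Fin n → ℝ) → (Fin n → ℝ))
    (ξv : (Fin n → ℝ) × (Fin m → ℝ) → (Fin m → ℝ)) (μ : Fin m) (i : Fin n)
    (w : Jet1 n m) : ℝ :=
  fderiv ℝ ξv (w.1, w.2.1) (Pi.single i 1, 0) μ
    + ∑ ν, w.2.2 ν i * fderiv ℝ ξv (w.1, w.2.1) (0, Pi.single ν 1) μ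
    - ∑ j, w.2.2 μ j * fderiv ℝ ξb w.1 (Pi.single i 1) j

/-- The action `ξ¹·G = Σ_j ξ^j ∂_{x^j}G + Σ_ν ξ^ν ∂_{y^ν}G + Σ_{ν,j} ξ^ν_j ∂_{z^ν_j}G` of
the first prolongation of a projectable vector field on a function `G` on `J¹`. -/
noncomputable def xiAct {n m : ℕ} (ξb : (Fin n → ℝ) → (Fin n → ℝ))
    (ξv : (Fin n → ℝ) × (Fin m → ℝ) → (Fin m → ℝ)) (G : Jet1 n m → ℝ)
    (w : Jet1 n m) : ℝ :=
  ∑ j, ξb w.1 j * fderiv ℝ G w (dxDir n m j)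
    + ∑ ν, ξv (w.1, w.2.1) ν * fderiv ℝ G w (dyDir n m ν)
    + ∑ ν, ∑ j, prolComp ξb ξv ν j w * fderiv ℝ G w (dzDir n m ν j)

/-- The divergence `div ξ̄ = Σ_i ∂_{x^i}ξ^i` of the base part of a projectable field. -/
noncomputable def divBase {n : ℕ} (ξb : (Fin n → ℝ) → (Fin n → ℝ)) (x : Fin n → ℝ) : ℝ :=
  ∑ i, fderiv ℝ ξb x (Pi.single i 1) i

/-- `ξ¹·G` is the derivative of `G` along the vector with components `(ξⁱ, ξ^μ, ξ^μ_i)`. -/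
theorem xiAct_eq_fderiv {n m : ℕ} (ξb : (Fin n → ℝ) → (Fin n → ℝ))
    (ξv : (Fin n → ℝ) × (Fin m → ℝ) → (Fin m → ℝ)) (G : Jet1 n m → ℝ) (w : Jet1 n m) :
    xiAct ξb ξv G w =
      fderiv ℝ G w (ξb w.1, ξv (w.1, w.2.1), fun μ i => prolComp ξb ξv μ i w) := by
  have hdecomp : ((ξb w.1, ξv (w.1, w.2.1), fun μ i => prolComp ξb ξv μ i w) : Jet1 n m) =
      ∑ j, ξb w.1 j • dxDir n m j + ∑ ν, ξv (w.1, w.2.1) ν • dyDir n m ν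
        + ∑ ν, ∑ j, prolComp ξb ξv ν j w • dzDir n m ν j := by
    refine Prod.ext ?_ (Prod.ext ?_ ?_)
    · ext i
      simp [dxDir, dyDir, dzDir, Prod.fst_sum, Finset.sum_apply, Pi.single_apply]
    · ext μ
      simp [dxDir, dyDir, dzDir, Prod.fst_sum, Prod.snd_sum, Finset.sum_apply, Pi.single_apply]
    · ext μ i
      simp [dxDir, dyDir, dzDir, Prod.snd_sum, Finset.sum_apply, Pi.single_apply]
  rw [hdecomp]
  simp only [map_add, map_sum, map_smul, smul_eq_mul, xiAct]

/-- The Leibniz rule for the density `p = −Σ z^μ_i F^i_μ`. -/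
theorem fderiv_neg_sum_jet_mul {n m : ℕ} {F : Fin n → Fin m → Jet1 n m → ℝ} {w : Jet1 n m}
    (hF : ∀ i μ, DifferentiableAt ℝ (F i μ) w) (v : Jet1 n m) :
    fderiv ℝ (fun w' : Jet1 n m => - ∑ μ, ∑ i, w'.2.2 μ i * F i μ w') w v =
      - ∑ μ, ∑ i, (v.2.2 μ i * F i μ w + w.2.2 μ i * fderiv ℝ (F i μ) w v) := by
  let Z (μ : Fin m) (i : Fin n) : Jet1 n m →L[ℝ] ℝ :=
    (ContinuousLinearMap.proj (R := ℝ) (φ := fun _ : Fin n => ℝ) i).comp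
      ((ContinuousLinearMap.proj (R := ℝ) (φ := fun _ : Fin m => Fin n → ℝ) μ).comp
        ((ContinuousLinearMap.snd ℝ (Fin m → ℝ) (Fin m → Fin n → ℝ)).comp
          (ContinuousLinearMap.snd ℝ (Fin n → ℝ) _)))
  have hz (μ : Fin m) (i : Fin n) :
      HasFDerivAt (fun w' : Jet1 n m => w'.2.2 μ i) (Z μ i) w :=
    (Z μ i).hasFDerivAt
  have hp := (HasFDerivAt.fun_sum (u := Finset.univ) fun μ _ =>
    HasFDerivAt.fun_sum (u := Finset.univ) fun i _ =>
      (hz μ i).mul (hF i μ).hasFDerivAt).fun_neg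
  refine (congrArg (fun L => L v) hp.fderiv).trans ?_
  simp [Z, mul_comm, add_comm]

/-- Contracting the prolongation components with the fluxes, with the indices of the two
first-order coupling terms exchanged. -/
theorem sum_prolComp_mul {n m : ℕ} (ξb : (Fin n → ℝ) → (Fin n → ℝ))
    (ξv : (Fin n → ℝ) × (Fin m → ℝ) → (Fin m → ℝ)) (f : Fin n → Fin m → ℝ) (w : Jet1 n m) :
    ∑ μ, ∑ i, prolComp ξb ξv μ i w * f i μ =
      ∑ μ, ∑ i, f i μ * fderiv ℝ ξv (w.1, w.2.1) (Pi.single i 1, 0) μ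
        + ∑ μ, ∑ i, w.2.2 μ i *
            (∑ ν, f i ν * fderiv ℝ ξv (w.1, w.2.1) (0, Pi.single μ 1) ν)
        - ∑ μ, ∑ i, w.2.2 μ i * (∑ j, f j μ * fderiv ℝ ξb w.1 (Pi.single j 1) i) := by
  have hy : ∑ μ, ∑ i, w.2.2 μ i *
        (∑ ν, f i ν * fderiv ℝ ξv (w.1, w.2.1) (0, Pi.single μ 1) ν) =
      ∑ μ, ∑ i, (∑ ν, w.2.2 ν i * fderiv ℝ ξv (w.1, w.2.1) (0, Pi.single ν 1) μ) * f i μ := by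
    simp only [Finset.mul_sum, Finset.sum_mul]
    rw [Finset.sum_comm, Finset.sum_comm (s := Finset.univ (α := Fin m))]
    refine Finset.sum_congr rfl fun i _ => ?_
    rw [Finset.sum_comm]
    exact Finset.sum_congr rfl fun μ _ => Finset.sum_congr rfl fun ν _ => by ring
  have hx : ∑ μ, ∑ i, w.2.2 μ i * (∑ j, f j μ * fderiv ℝ ξb w.1 (Pi.single j 1) i) =
      ∑ μ, ∑ i, (∑ j, w.2.2 μ j * fderiv ℝ ξb w.1 (Pi.single i 1) j) * f i μ := by
    simp only [Finset.mul_sum, Finset.sum_mul]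
    refine Finset.sum_congr rfl fun μ _ => ?_
    rw [Finset.sum_comm]
    exact Finset.sum_congr rfl fun i _ => Finset.sum_congr rfl fun j _ => by ring
  rw [hy, hx]
  simp only [← Finset.sum_add_distrib, ← Finset.sum_sub_distrib, prolComp]
  exact Finset.sum_congr rfl fun μ _ => Finset.sum_congr rfl fun i _ => by ring

/-- If a projectable vector field satisfies the flux symmetry equations of a constitutive
relation `C` identically on `J¹`, then it also satisfies the `p`-symmetry equation of the
lifted covering constitutive relation (with `p = −Σ z^μ_i F^i_μ`): symmetries of `C` are
automatically symmetries of its lifted covering constitutive relation. -/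
theorem lifted_CCR_p_symmetry {n m : ℕ}
    (F : Fin n → Fin m → Jet1 n m → ℝ) (hF : ∀ i μ, ContDiff ℝ (⊤ : ℕ∞) (F i μ))
    (ξb : (Fin n → ℝ) → (Fin n → ℝ))
    (ξv : (Fin n → ℝ) × (Fin m → ℝ) → (Fin m → ℝ))
    (hξb : ContDiff ℝ (⊤ : ℕ∞) ξb) (hξv : ContDiff ℝ (⊤ : ℕ∞) ξv)
    -- the flux symmetry equations II hold identically on `J¹`
    (hflux : ∀ (μ : Fin m) (i : Fin n) (w : Jet1 n m),
      xiAct ξb ξv (F i μ) w + divBase ξb w.1 * F i μ w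
        + ∑ ν, F i ν w * fderiv ℝ ξv (w.1, w.2.1) (0, Pi.single μ 1) ν
        - ∑ j, F j μ w * fderiv ℝ ξb w.1 (Pi.single j 1) i = 0) :
    -- the `p`-symmetry equation I holds identically on `J¹`
    ∀ w : Jet1 n m,
      xiAct ξb ξv (fun w' => - ∑ μ, ∑ i, w'.2.2 μ i * F i μ w') w
        + divBase ξb w.1 * (- ∑ μ, ∑ i, w.2.2 μ i * F i μ w)
        + ∑ μ, ∑ i, F i μ w * fderiv ℝ ξv (w.1, w.2.1) (Pi.single i 1, 0) μ = 0 := by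
  intro w
  have hsum : ∑ μ, ∑ i, w.2.2 μ i * (xiAct ξb ξv (F i μ) w + divBase ξb w.1 * F i μ w
        + ∑ ν, F i ν w * fderiv ℝ ξv (w.1, w.2.1) (0, Pi.single μ 1) ν
        - ∑ j, F j μ w * fderiv ℝ ξb w.1 (Pi.single j 1) i) = 0 :=
    Finset.sum_eq_zero fun μ _ => Finset.sum_eq_zero fun i _ => by rw [hflux, mul_zero]
  have hdiv : ∑ μ, ∑ i, w.2.2 μ i * (divBase ξb w.1 * F i μ w) =
      divBase ξb w.1 * ∑ μ, ∑ i, w.2.2 μ i * F i μ w := by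
    simp only [Finset.mul_sum, mul_left_comm]
  have hprol := sum_prolComp_mul ξb ξv (fun i μ => F i μ w) w
  have hdiff (i : Fin n) (μ : Fin m) : DifferentiableAt ℝ (F i μ) w :=
    ((hF i μ).differentiable (by simp)).differentiableAt
  rw [xiAct_eq_fderiv, fderiv_neg_sum_jet_mul hdiff]
  simp only [← xiAct_eq_fderiv, Finset.sum_add_distrib]
  simp only [mul_add, mul_sub, Finset.sum_add_distrib, Finset.sum_sub_distrib] at hsum
  linarith
end

section
/- Let n ≥ 2, m ≥ 1, let U ⊆ ℝᵐ be open and convex, let F^A_μ : U → ℝ (A = 1,…,n−1, μ = 1,…,m) be smooth flux components, and let Π_μ : ℝ × ℝ^{n−1} × U → ℝ be smooth sources (RET-type constitutive relation with densities F^0_μ = y^μ). Suppose h⁰ : U → ℝ is smooth and satisfies the compatibility system: for all A, σ, ν, Σ_μ ∂_{y^σ}F^A_μ · ∂_{y^μ}∂_{y^ν}h⁰ = Σ_μ ∂_{y^ν}F^A_μ · ∂_{y^μ}∂_{y^σ}h⁰ on U. Then there exist smooth entropy fluxes h^A : U → ℝ with ∂_{y^σ}h^A = Σ_μ ∂_{y^μ}h⁰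 · ∂_{y^σ}F^A_μ for all σ and A, and every C¹ map s : ℝ × ℝ^{n−1} → U solving the RET balance system ∂_t s^μ(t,x) + Σ_A ∂_{x^A}[F^A_μ(s(t,x))] = Π_μ(t,x,s(t,x)) (for all μ) also satisfies the secondary balance law ∂_t[h⁰(s(t,x))] + Σ_A ∂_{x^A}[h^A(s(t,x))] = Σ_μ ∂_{y^μ}h⁰(s(t,x)) · Π_μ(t,x,s(t,x)), with Lagrange–Liu multipliers λ^μ = ∂_{y^μ}h⁰. -/
open scoped BigOperators

open scoped ContDiff

section EntropyFlux

variable {ι κ E : Type*} [Fintype ι] [Fintype κ] [NormedAddCommGroup E] [NormedSpace ℝ E]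

/-- A continuous linear functional on `ι → ℝ` is determined by its values on the standard basis. -/
lemma ContinuousLinearMap.apply_eq_sum_single_mul [DecidableEq ι] (L : (ι → ℝ) →L[ℝ] ℝ)
    (v : ι → ℝ) : L v = ∑ i, L (Pi.single i 1) * v i := by
  conv_lhs => rw [pi_eq_sum_univ' v]
  simp [mul_comm, Pi.single]

/-- A bilinear map on `ι → ℝ` which is symmetric on the standard basis is symmetric. -/
lemma ContinuousLinearMap.symmetric_of_single [DecidableEq ι]
    (B : (ι → ℝ) →L[ℝ] (ι → ℝ) →L[ℝ] ℝ)
    (h : ∀ i j, B (Pi.single i 1) (Pi.single j 1) = B (Pi.single j 1) (Pi.single i 1))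
    (v w : ι → ℝ) : B v w = B w v := by
  have key : B = B.flip := by
    apply ContinuousLinearMap.coe_injective
    refine (Pi.basisFun ℝ ι).ext fun i => ?_
    apply ContinuousLinearMap.coe_injective
    refine (Pi.basisFun ℝ ι).ext fun j => ?_
    simpa using h i j
  exact DFunLike.congr_fun (DFunLike.congr_fun key v) w

/-- Partial derivatives of a smooth function on an open set are smooth. -/
lemma ContDiffOn.fderiv_apply_const_of_isOpen {f : E → ℝ} {U : Set E}
    (hf : ContDiffOn ℝ ∞ f U) (hU : IsOpen U) (v : E) :
    ContDiffOn ℝ ∞ (fun y => fderiv ℝ f y v) U :=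
  ((contDiffOn_infty_iff_fderiv_of_isOpen hU).1 hf).2.clm_apply contDiffOn_const

/-- The second derivative of a smooth function on an open set is symmetric. -/
lemma ContDiffOn.isSymmSndFDerivAt_of_isOpen {f : E → ℝ} {U : Set E}
    (hf : ContDiffOn ℝ ∞ f U) (hU : IsOpen U) {y : E} (hy : y ∈ U) : IsSymmSndFDerivAt ℝ f y :=
  (hf.contDiffAt (hU.mem_nhds hy)).isSymmSndFDerivAt
    (by simpa using WithTop.coe_le_coe.2 (le_top (a := (2 : ℕ∞))))

/-- Second-order partial derivatives of a smooth function on an open set commute. -/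
lemma ContDiffOn.fderiv_fderiv_apply_comm {f : E → ℝ} {U : Set E}
    (hf : ContDiffOn ℝ ∞ f U) (hU : IsOpen U) {y : E} (hy : y ∈ U) (v w : E) :
    fderiv ℝ (fun z => fderiv ℝ f z v) y w = fderiv ℝ (fun z => fderiv ℝ f z w) y v := by
  have hd : DifferentiableAt ℝ (fderiv ℝ f) y :=
    (((contDiffOn_infty_iff_fderiv_of_isOpen hU).1 hf).2.contDiffAt
      (hU.mem_nhds hy)).differentiableAt (by simp)
  have hs : IsSymmSndFDerivAt ℝ f y :=
    hf.isSymmSndFDerivAt_of_isOpen hU hy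
  rw [fderiv_clm_apply hd (differentiableAt_const v), fderiv_clm_apply hd (differentiableAt_const w)]
  simpa using hs.eq w v

/-- The form `∑ μ, g μ • dF μ` on an open convex set has a smooth primitive as soon as
`∑ μ, dg μ ⊗ dF μ` is symmetric. -/
lemma Convex.exists_contDiffOn_hasFDerivAt_sum_smul_fderiv {U : Set E} (hUconv : Convex ℝ U)
    (hU : IsOpen U) {F g : κ → E → ℝ} (hF : ∀ μ, ContDiffOn ℝ ∞ (F μ) U)
    (hg : ∀ μ, ContDiffOn ℝ ∞ (g μ) U)
    (hsymm : ∀ y ∈ U, ∀ v w, ∑ μ, fderiv ℝ (g μ) y v * fderiv ℝ (F μ) y w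
      = ∑ μ, fderiv ℝ (g μ) y w * fderiv ℝ (F μ) y v) :
    ∃ h : E → ℝ, ContDiffOn ℝ ∞ h U ∧
      ∀ y ∈ U, HasFDerivAt h (∑ μ, g μ y • fderiv ℝ (F μ) y) y := by
  have hF' : ∀ μ, ContDiffOn ℝ ∞ (fderiv ℝ (F μ)) U := fun μ =>
    ((contDiffOn_infty_iff_fderiv_of_isOpen hU).1 (hF μ)).2
  have hω : ContDiffOn ℝ ∞ (fun y => ∑ μ, g μ y • fderiv ℝ (F μ) y) U :=
    ContDiffOn.sum fun μ _ => (hg μ).smul (hF' μ)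
  have hdω : ∀ y ∈ U, ∀ v w, fderiv ℝ (fun y => ∑ μ, g μ y • fderiv ℝ (F μ) y) y v w
      = fderiv ℝ (fun y => ∑ μ, g μ y • fderiv ℝ (F μ) y) y w v := by
    intro y hy v w
    have hyU := hU.mem_nhds hy
    have hd : HasFDerivAt (fun y => ∑ μ, g μ y • fderiv ℝ (F μ) y)
        (∑ μ, (g μ y • fderiv ℝ (fderiv ℝ (F μ)) y
          + (fderiv ℝ (g μ) y).smulRight (fderiv ℝ (F μ) y))) y :=
      HasFDerivAt.fun_sum fun μ _ =>
        (((hg μ).contDiffAt hyU).differentiableAt (by simp)).hasFDerivAt.smul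
          (((hF' μ).contDiffAt hyU).differentiableAt (by simp)).hasFDerivAt
    have hs : ∀ μ, fderiv ℝ (fderiv ℝ (F μ)) y v w = fderiv ℝ (fderiv ℝ (F μ)) y w v := fun μ =>
      ((hF μ).isSymmSndFDerivAt_of_isOpen hU hy).eq v w
    rw [hd.fderiv]
    simp [Finset.sum_add_distrib, hs, hsymm y hy v w]
  obtain ⟨h, hh⟩ := hUconv.exists_forall_hasFDerivAt_of_fderiv_symmetric hU
    (hω.differentiableOn (by simp)) hdω
  refine ⟨h, (contDiffOn_infty_iff_fderiv_of_isOpen hU).2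
    ⟨fun y hy => (hh y hy).differentiableAt.differentiableWithinAt, ?_⟩, hh⟩
  exact hω.congr fun y hy => (hh y hy).fderiv

end EntropyFlux

/-- Entropy principle for RET-type balance systems: if `h⁰` satisfies the compatibility
(integrability) system `(η^A_σ ∂_{y^ν} − η^A_ν ∂_{y^σ})h⁰ = 0` on the open convex domain
`U`, then there exist entropy fluxes `h^A` with `∂_{y^σ}h^A = Σ_μ ∂_{y^μ}h⁰ ∂_{y^σ}F^A_μ`,
and every solution of the RET balance system satisfies the secondary balance law
`∂_t[h⁰∘s] + Σ_A ∂_{x^A}[h^A∘s] = Σ_μ ∂_{y^μ}h⁰ Π_μ` with Lagrange–Liu multipliers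
`λ^μ = ∂_{y^μ}h⁰`. -/
theorem RET_secondary_balance_law {n m : ℕ} (hn : 2 ≤ n) (hm : 1 ≤ m)
    (U : Set (Fin m → ℝ)) (hU : IsOpen U) (hUconv : Convex ℝ U)
    (F : Fin (n - 1) → Fin m → (Fin m → ℝ) → ℝ)
    (hF : ∀ A μ, ContDiffOn ℝ (⊤ : ℕ∞) (F A μ) U)
    (Pr : Fin m → ℝ × (Fin (n - 1) → ℝ) × (Fin m → ℝ) → ℝ)
    (hPr : ∀ μ, ContDiffOn ℝ (⊤ : ℕ∞) (Pr μ) {p | p.2.2 ∈ U})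
    (h0 : (Fin m → ℝ) → ℝ) (hh0 : ContDiffOn ℝ (⊤ : ℕ∞) h0 U)
    -- the compatibility system on `h⁰`
    (hcompat : ∀ (A : Fin (n - 1)) (σ ν : Fin m), ∀ y ∈ U,
      ∑ μ, fderiv ℝ (F A μ) y (Pi.single σ 1) *
          fderiv ℝ (fun y' => fderiv ℝ h0 y' (Pi.single ν 1)) y (Pi.single μ 1)
        = ∑ μ, fderiv ℝ (F A μ) y (Pi.single ν 1) *
            fderiv ℝ (fun y' => fderiv ℝ h0 y' (Pi.single σ 1)) y (Pi.single μ 1)) :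
    ∃ h : Fin (n - 1) → (Fin m → ℝ) → ℝ,
      (∀ A, ContDiffOn ℝ (⊤ : ℕ∞) (h A) U)
      ∧ (∀ (A : Fin (n - 1)) (σ : Fin m), ∀ y ∈ U,
          fderiv ℝ (h A) y (Pi.single σ 1)
            = ∑ μ, fderiv ℝ h0 y (Pi.single μ 1) * fderiv ℝ (F A μ) y (Pi.single σ 1))
      ∧ (∀ s : ℝ × (Fin (n - 1) → ℝ) → (Fin m → ℝ), ContDiff ℝ 1 s →
          (∀ p : ℝ × (Fin (n - 1) → ℝ), s p ∈ U) →
          -- `s` solves the RET balance system `∂_t s^μ + Σ_A ∂_{x^A}[F^A_μ∘s] = Π_μ`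
          (∀ (μ : Fin m) (p : ℝ × (Fin (n - 1) → ℝ)),
            fderiv ℝ (fun p' => s p' μ) p (1, 0)
              + ∑ A, fderiv ℝ (fun p' => F A μ (s p')) p (0, Pi.single A 1)
              = Pr μ (p.1, p.2, s p)) →
          -- the secondary (entropy) balance law
          ∀ p : ℝ × (Fin (n - 1) → ℝ),
            fderiv ℝ (fun p' => h0 (s p')) p (1, 0)
              + ∑ A, fderiv ℝ (fun p' => h A (s p')) p (0, Pi.single A 1)
              = ∑ μ, fderiv ℝ h0 (s p) (Pi.single μ 1) * Pr μ (p.1, p.2, s p)) := by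
  have hex : ∀ A, ∃ h : (Fin m → ℝ) → ℝ, ContDiffOn ℝ ∞ h U ∧ ∀ y ∈ U, HasFDerivAt h
      (∑ μ, fderiv ℝ h0 y (Pi.single μ 1) • fderiv ℝ (F A μ) y) y := by
    intro A
    refine hUconv.exists_contDiffOn_hasFDerivAt_sum_smul_fderiv hU (hF A)
      (g := fun μ y => fderiv ℝ h0 y (Pi.single μ 1))
      (fun μ => hh0.fderiv_apply_const_of_isOpen hU _) fun y hy => ?_
    have hB := ContinuousLinearMap.symmetric_of_single
      (∑ μ, (fderiv ℝ (fun y => fderiv ℝ h0 y (Pi.single μ 1)) y).smulRight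
        (fderiv ℝ (F A μ) y)) fun ν σ => by
      have hswap := fun μ τ : Fin m =>
        hh0.fderiv_fderiv_apply_comm hU hy (Pi.single τ 1) (Pi.single μ 1)
      have hc := hcompat A σ ν y hy
      simp_rw [hswap _ ν, hswap _ σ] at hc
      simpa [mul_comm] using hc
    simpa using hB
  choose h hsmooth hderiv using hex
  refine ⟨h, hsmooth, fun A σ y hy => ?_, fun s hs hsU hbal p => ?_⟩
  · simp [(hderiv A y hy).fderiv]
  have hsd : HasFDerivAt s (fderiv ℝ s p) p := (hs.differentiable (by simp) p).hasFDerivAt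
  have hdiff : ∀ {f : (Fin m → ℝ) → ℝ}, ContDiffOn ℝ ∞ f U →
      HasFDerivAt f (fderiv ℝ f (s p)) (s p) := fun hf =>
    ((hf.contDiffAt (hU.mem_nhds (hsU p))).differentiableAt (by simp)).hasFDerivAt
  have hcomp : ∀ {f : (Fin m → ℝ) → ℝ}, ContDiffOn ℝ ∞ f U → ∀ v,
      fderiv ℝ (fun q => f (s q)) p v = fderiv ℝ f (s p) (fderiv ℝ s p v) := fun hf v =>
    DFunLike.congr_fun ((hdiff hf).comp p hsd).fderiv v
  have hcoord : ∀ μ v, fderiv ℝ (fun q => s q μ) p v = fderiv ℝ s p v μ := fun μ v =>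
    DFunLike.congr_fun (hasFDerivAt_pi'.1 hsd μ).fderiv v
  simp only [hcomp hh0, hcomp (hsmooth _), ← hbal, hcomp (hF _ _), hcoord,
    (hderiv _ _ (hsU p)).fderiv]
  rw [ContinuousLinearMap.apply_eq_sum_single_mul (fderiv ℝ h0 (s p))]
  simp only [sum_apply, smul_apply, smul_eq_mul,
    mul_add, Finset.mul_sum, Finset.sum_add_distrib]
  rw [Finset.sum_comm]
end

section
/- Let τ, Λ, λ⁰, ε^{eq} : ℝ → ℝ be smooth with Λ'(θ) ≠ 0 and λ⁰'(θ) ≠ 0 for all θ. Define the internal energy ε : ℝ × ℝ³ → ℝ by ε(θ, q) = ε^{eq}(θ) + [ τ'(θ)/(2Λ'(θ)) − (τ(θ)/(2λ⁰'(θ))) · (λ⁰'/Λ')'(θ) ] · ‖q‖², and let E : ℝ → ℝ be an antiderivative of θ ↦ λ⁰'(θ) ε^{eq}(θ). Suppose (θ, q) : ℝ × ℝ³ → ℝ × ℝ³ is a C² solution of the Cattaneo heat propagation system: ∂_t[ε(θ(t,x), q(t,x))] + div_x q(t,x) = 0 and ∂_t[τ(θ(t,x)) q^A(t,x)] + ∂_{x^A}[Λ(θ(t,x))]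 = −q^A(t,x) for A = 1,2,3. Then the secondary balance law holds: ∂_t[ λ⁰(θ) ε(θ, q) − E(θ) + (1/2) τ(θ) (λ⁰'(θ)/Λ'(θ)) ‖q‖² ] + div_x[ λ⁰(θ) q ] = − (λ⁰'(θ)/Λ'(θ)) ‖q‖² at every (t,x). -/
open scoped BigOperators

/-- Squared euclidean norm `‖q‖²` of a heat flux vector `q ∈ ℝ³`. -/
def sqNorm (q : Fin 3 → ℝ) : ℝ := ∑ A, (q A) ^ 2

/-- The special form of the internal energy of the Cattaneo model:
`ε(θ,q) = ε^{eq}(θ) + [τ'/(2Λ') − (τ/(2λ⁰'))·(λ⁰'/Λ')'](θ) ‖q‖²`. -/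
noncomputable def catEnergy (tau Lam lam0 eeq : ℝ → ℝ) (θ : ℝ) (q : Fin 3 → ℝ) : ℝ :=
  eeq θ + (deriv tau θ / (2 * deriv Lam θ)
    - (tau θ / (2 * deriv lam0 θ)) * deriv (fun t => deriv lam0 t / deriv Lam t) θ)
      * sqNorm q

theorem contDiff_sqNorm {n : WithTop ℕ∞} : ContDiff ℝ n sqNorm := by
  unfold sqNorm
  fun_prop

theorem HasFDerivAt.sqNorm {V : Type*} [NormedAddCommGroup V] [NormedSpace ℝ V]
    {q : V → Fin 3 → ℝ} {q' : Fin 3 → V →L[ℝ] ℝ} {p : V}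
    (hq : ∀ A, HasFDerivAt (fun x => q x A) (q' A) p) :
    HasFDerivAt (fun x => sqNorm (q x)) (∑ A, (2 * q p A) • q' A) p := by
  unfold _root_.sqNorm
  refine HasFDerivAt.fun_sum fun A _ => ?_
  simpa using (hq A).pow 2

theorem ContDiff.differentiable_deriv {f : ℝ → ℝ} (hf : ContDiff ℝ (⊤ : ℕ∞) f) :
    Differentiable ℝ (deriv f) :=
  (contDiff_infty_iff_deriv.1 hf).2.differentiable (by simp)

theorem differentiable_catEnergy_comp {V : Type*} [NormedAddCommGroup V] [NormedSpace ℝ V]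
    {tau Lam lam0 eeq : ℝ → ℝ}
    (htau : ContDiff ℝ (⊤ : ℕ∞) tau) (hLam : ContDiff ℝ (⊤ : ℕ∞) Lam)
    (hlam0 : ContDiff ℝ (⊤ : ℕ∞) lam0) (heeq : ContDiff ℝ (⊤ : ℕ∞) eeq)
    (hLam' : ∀ t : ℝ, deriv Lam t ≠ 0) (hlam0' : ∀ t : ℝ, deriv lam0 t ≠ 0)
    {θ : V → ℝ} {q : V → Fin 3 → ℝ} (hθ : Differentiable ℝ θ) (hq : Differentiable ℝ q) :
    Differentiable ℝ (fun x => catEnergy tau Lam lam0 eeq (θ x) (q x)) := by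
  have hk : ContDiff ℝ (⊤ : ℕ∞) (fun t => deriv lam0 t / deriv Lam t) :=
    (contDiff_infty_iff_deriv.1 hlam0).2.div (contDiff_infty_iff_deriv.1 hLam).2 hLam'
  have hk' := hk.differentiable_deriv
  have htau' := htau.differentiable_deriv
  have hL' := hLam.differentiable_deriv
  have hl' := hlam0.differentiable_deriv
  have ht := htau.differentiable (by simp)
  have he := heeq.differentiable (by simp)
  have hN : Differentiable ℝ sqNorm := (contDiff_sqNorm (n := 1)).differentiable (by simp)
  have h2L : ∀ t, 2 * deriv Lam t ≠ 0 := fun t => mul_ne_zero two_ne_zero (hLam' t)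
  have h2l : ∀ t, 2 * deriv lam0 t ≠ 0 := fun t => mul_ne_zero two_ne_zero (hlam0' t)
  have hc : Differentiable ℝ (fun t => deriv tau t / (2 * deriv Lam t)
      - (tau t / (2 * deriv lam0 t)) * deriv (fun t => deriv lam0 t / deriv Lam t) t) :=
    (htau'.fun_div (hL'.const_mul 2) h2L).fun_sub
      ((ht.fun_div (hl'.const_mul 2) h2l).fun_mul hk')
  exact (he.comp hθ).fun_add ((hc.comp hθ).fun_mul (hN.comp hq))

/-- The entropy-type secondary balance law of the Cattaneo heat propagation model: if the
internal energy has the special form `catEnergy`, then along every solution of the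
Cattaneo system `∂_t ε + div q = 0`, `∂_t(τ(θ)q) + ∇Λ(θ) = −q`, one has
`∂_t[λ⁰ε − E + ½τ(λ⁰'/Λ')‖q‖²] + div(λ⁰q) = −(λ⁰'/Λ')‖q‖²`. -/
theorem cattaneo_secondary_balance_law
    (tau Lam lam0 eeq E : ℝ → ℝ)
    (htau : ContDiff ℝ (⊤ : ℕ∞) tau) (hLam : ContDiff ℝ (⊤ : ℕ∞) Lam)
    (hlam0 : ContDiff ℝ (⊤ : ℕ∞) lam0) (heeq : ContDiff ℝ (⊤ : ℕ∞) eeq)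
    (hLam' : ∀ t : ℝ, deriv Lam t ≠ 0) (hlam0' : ∀ t : ℝ, deriv lam0 t ≠ 0)
    -- `E` is an antiderivative of `θ ↦ λ⁰'(θ) ε^{eq}(θ)`
    (hE : ∀ t : ℝ, HasDerivAt E (deriv lam0 t * eeq t) t)
    (θ : ℝ × (Fin 3 → ℝ) → ℝ) (q : ℝ × (Fin 3 → ℝ) → (Fin 3 → ℝ))
    (hθ : ContDiff ℝ 2 θ) (hq : ContDiff ℝ 2 q)
    -- energy balance: `∂_t ε + div_x q = 0`
    (heq1 : ∀ p : ℝ × (Fin 3 → ℝ),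
      fderiv ℝ (fun p' => catEnergy tau Lam lam0 eeq (θ p') (q p')) p (1, 0)
        + ∑ A, fderiv ℝ (fun p' => q p' A) p (0, Pi.single A 1) = 0)
    -- Cattaneo law: `∂_t(τ(θ) q^A) + ∂_{x^A} Λ(θ) = −q^A`
    (heq2 : ∀ (A : Fin 3) (p : ℝ × (Fin 3 → ℝ)),
      fderiv ℝ (fun p' => tau (θ p') * q p' A) p (1, 0)
        + fderiv ℝ (fun p' => Lam (θ p')) p (0, Pi.single A 1) = - q p A) :
    ∀ p : ℝ × (Fin 3 → ℝ),
      fderiv ℝ (fun p' =>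
          lam0 (θ p') * catEnergy tau Lam lam0 eeq (θ p') (q p') - E (θ p')
            + (1 / 2) * tau (θ p') * (deriv lam0 (θ p') / deriv Lam (θ p'))
                * sqNorm (q p')) p (1, 0)
        + ∑ A, fderiv ℝ (fun p' => lam0 (θ p') * q p' A) p (0, Pi.single A 1)
        = - (deriv lam0 (θ p) / deriv Lam (θ p)) * sqNorm (q p) := by
  intro p
  have hθd : Differentiable ℝ θ := hθ.differentiable (by simp)
  have hqd : Differentiable ℝ q := hq.differentiable (by simp)
  have hθp := (hθd p).hasFDerivAt
  have hqp : ∀ A, HasFDerivAt (fun x => q x A) (fderiv ℝ (fun x => q x A) p) p :=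
    fun A => (differentiableAt_pi.1 (hqd p) A).hasFDerivAt
  have hε := (differentiable_catEnergy_comp htau hLam hlam0 heeq hLam' hlam0' hθd hqd
    p).hasFDerivAt
  have hN := HasFDerivAt.sqNorm hqp
  have hcomp {f : ℝ → ℝ} (hf : Differentiable ℝ f) :
      HasFDerivAt (fun x => f (θ x)) (deriv f (θ p) • fderiv ℝ θ p) p :=
    (hf (θ p)).hasDerivAt.comp_hasFDerivAt p hθp
  have hτ := hcomp (htau.differentiable (by simp))
  have hl := hcomp (hlam0.differentiable (by simp))
  have hL := hcomp (hLam.differentiable (by simp))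
  have hk := hcomp (hlam0.differentiable_deriv.fun_div hLam.differentiable_deriv hLam')
  have hEp := (hE (θ p)).comp_hasFDerivAt p hθp
  have hF := ((hl.fun_mul hε).fun_sub hEp).fun_add (((hτ.const_mul (1 / 2)).fun_mul hk).fun_mul hN)
  have h1 := heq1 p
  have h2 := fun A => heq2 A p
  simp only [(hτ.fun_mul (hqp _)).fderiv, hL.fderiv] at h2
  simp only [Function.comp_def] at hF
  rw [hF.fderiv]
  simp only [(hl.fun_mul (hqp _)).fderiv]
  have h20 := h2 0
  have h21 := h2 1
  have h22 := h2 2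
  have hLp := hLam' (θ p)
  have hlp := hlam0' (θ p)
  simp only [Fin.sum_univ_three, add_apply, sub_apply,
    smul_apply, smul_eq_mul] at h1 h20 h21 h22 ⊢
  generalize fderiv ℝ (fun x => catEnergy tau Lam lam0 eeq (θ x) (q x)) p (1, 0) = εt at *
  simp only [catEnergy, sqNorm, Fin.sum_univ_three]
  generalize deriv (fun t => deriv lam0 t / deriv Lam t) (θ p) = k' at *
  field_simp
  linear_combination 2 * deriv Lam (θ p) * lam0 (θ p) * h1
    + 2 * deriv lam0 (θ p) * (q p 0 * h20 + q p 1 * h21 + q p 2 * h22)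
end
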